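/- Let G(V,E) be a chordal graph with maximal cliques C_1, …, C_p, and let Z ∈ S^n(E,0). Then Z ∈ S^n_+(E,0) (i.e., Z is positive semidefinite with sparsity pattern E) if and only if there exist matrices Z_k ∈ S^{|C_k|} with Z_k ⪰ 0 for k = 1, …, p such that Z = Σ_{k=1}^p E_{C_k}^T Z_k E_{C_k}. -/

import Mathlib

open Matrix BigOperators

/-- The edge set augmented with all self-loops: `E* = E ∪ {(i,i) : i ∈ V}`. -/
def EStar {n : ℕ} (E : Set (Fin n × Fin n)) : Set (Fin n × Fin n) :=
  E ∪ {q | q.1 = q.2}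

/-- The edge set of an undirected graph is symmetric. -/
def SymmEdges {n : ℕ} (E : Set (Fin n × Fin n)) : Prop :=
  ∀ i j : Fin n, (i, j) ∈ E → (j, i) ∈ E

/-- `S^n(E,0)`: real symmetric `n × n` matrices vanishing outside `E*`. -/
def SparseSym {n : ℕ} (E : Set (Fin n × Fin n)) (X : Matrix (Fin n) (Fin n) ℝ) : Prop :=
  X.IsSymm ∧ ∀ i j : Fin n, (i, j) ∉ EStar E → X i j = 0

/-- `S^n_+(E,?)`: matrices in `S^n(E,0)` admitting a positive semidefinite completion. -/
def PSDCompletable {n : ℕ} (E : Set (Fin n × Fin n)) (X : Matrix (Fin n) (Fin n) ℝ) : Prop :=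
  SparseSym E X ∧ ∃ M : Matrix (Fin n) (Fin n) ℝ, M.PosSemidef ∧
    ∀ i j : Fin n, (i, j) ∈ EStar E → M i j = X i j

/-- `S^n_+(E,0)`: positive semidefinite matrices with sparsity pattern `E`. -/
def SparsePSD {n : ℕ} (E : Set (Fin n × Fin n)) (X : Matrix (Fin n) (Fin n) ℝ) : Prop :=
  SparseSym E X ∧ X.PosSemidef

/-- The selector matrix `E_C ∈ R^{|C| × n}` of a subset `C ⊆ {1,…,n}`:
`(E_C)_{ij} = 1` if the `i`-th smallest element of `C` equals `j`, and `0` otherwise. -/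
def selector {n : ℕ} (C : Finset (Fin n)) : Matrix (Fin C.card) (Fin n) ℝ :=
  Matrix.of fun i j => if (C.orderIsoOfFin rfl i).1 = j then 1 else 0

/-- A clique: a subset of vertices inducing a complete subgraph. -/
def IsClique {n : ℕ} (E : Set (Fin n × Fin n)) (C : Finset (Fin n)) : Prop :=
  ∀ i ∈ C, ∀ j ∈ C, i ≠ j → (i, j) ∈ E

/-- A maximal clique: a clique not contained in any other clique. -/
def IsMaximalClique {n : ℕ} (E : Set (Fin n × Fin n)) (C : Finset (Fin n)) : Prop :=
  IsClique E C ∧ ∀ D : Finset (Fin n), IsClique E D → C ⊆ D → D = C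

/-- A cycle of length `k+1`: pairwise distinct vertices consecutively adjacent (cyclically). -/
def IsCycle {n : ℕ} (E : Set (Fin n × Fin n)) {k : ℕ} (v : Fin (k + 1) → Fin n) : Prop :=
  Function.Injective v ∧ ∀ i : Fin (k + 1), (v i, v (i + 1)) ∈ E

/-- A chord: an edge joining two non-consecutive vertices of the cycle. -/
def HasChord {n : ℕ} (E : Set (Fin n × Fin n)) {k : ℕ} (v : Fin (k + 1) → Fin n) : Prop :=
  ∃ i j : Fin (k + 1), i ≠ j ∧ j ≠ i + 1 ∧ i ≠ j + 1 ∧ (v i, v j) ∈ E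

/-- A graph is chordal if every cycle of length at least four has a chord. -/
def IsChordal {n : ℕ} (E : Set (Fin n × Fin n)) : Prop :=
  ∀ k : ℕ, 4 ≤ k + 1 → ∀ v : Fin (k + 1) → Fin n, IsCycle E v → HasChord E v

/-- A vertex whose neighbours in `S` are pairwise adjacent. -/
def IsSimplicialIn {n : ℕ} (E : Set (Fin n × Fin n)) (S : Finset (Fin n)) (x : Fin n) : Prop :=
  ∀ a ∈ S, ∀ b ∈ S, (x, a) ∈ E → (x, b) ∈ E → a ≠ b → (a, b) ∈ E

/-- A walk `f 0, …, f m` from `a` to `b` all of whose inner vertices lie in `T`. -/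
def IsWalkThrough {n : ℕ} (E : Set (Fin n × Fin n)) (T : Set (Fin n)) (a b : Fin n) (m : ℕ)
    (f : ℕ → Fin n) : Prop :=
  f 0 = a ∧ f m = b ∧ (∀ i < m, (f i, f (i + 1)) ∈ E) ∧ ∀ i, 0 < i → i < m → f i ∈ T

/-- Replacing the stretch of a walk between `i` and `j` by an edge gives a walk. -/
lemma IsWalkThrough.shortcut {n : ℕ} {E : Set (Fin n × Fin n)} {T : Set (Fin n)} {a b : Fin n}
    {m : ℕ} {f : ℕ → Fin n} (hf : IsWalkThrough E T a b m f) {i j : ℕ} (hij : i + 2 ≤ j)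
    (hjm : j ≤ m) (h : (f i, f j) ∈ E) :
    ∃ g, IsWalkThrough E T a b (m - (j - i - 1)) g := by
  obtain ⟨h0, hm, hadj, hT⟩ := hf
  refine ⟨fun t => if t ≤ i then f t else f (t + (j - i - 1)), by simpa using h0, ?_, ?_, ?_⟩
  · dsimp only
    rw [if_neg (by omega), Nat.sub_add_cancel (by omega), hm]
  · intro t ht
    dsimp only
    rcases lt_trichotomy t i with h1 | h1 | h1
    · rw [if_pos (by omega), if_pos (by omega)]
      exact hadj t (by omega)
    · subst h1
      rw [if_pos le_rfl, if_neg (by omega), show t + 1 + (j - t - 1) = j by omega]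
      exact h
    · rw [if_neg (by omega), if_neg (by omega),
        show t + 1 + (j - i - 1) = t + (j - i - 1) + 1 by omega]
      exact hadj _ (by omega)
  · intro t h1 h2
    dsimp only
    split_ifs
    · exact hT t h1 (by omega)
    · exact hT _ (by omega) (by omega)

/-- A closed stretch of a walk can be removed. -/
lemma IsWalkThrough.removeLoop {n : ℕ} {E : Set (Fin n × Fin n)} {T : Set (Fin n)} {a b : Fin n}
    {m : ℕ} {f : ℕ → Fin n} (hf : IsWalkThrough E T a b m f) {i j : ℕ} (hij : i < j)
    (hjm : j ≤ m) (h : f i = f j) :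
    ∃ g, IsWalkThrough E T a b (m - (j - i)) g := by
  obtain ⟨h0, hm, hadj, hT⟩ := hf
  refine ⟨fun t => if t ≤ i then f t else f (t + (j - i)), by simpa using h0, ?_, ?_, ?_⟩
  · dsimp only
    split_ifs with h1
    · rw [show m - (j - i) = i by omega, h, show j = m by omega, hm]
    · rw [Nat.sub_add_cancel (by omega), hm]
  · intro t ht
    dsimp only
    rcases lt_trichotomy t i with h1 | h1 | h1
    · rw [if_pos (by omega), if_pos (by omega)]
      exact hadj t (by omega)
    · subst h1
      rw [if_pos le_rfl, if_neg (by omega), show t + 1 + (j - t) = j + 1 by omega, h]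
      exact hadj j (by omega)
    · rw [if_neg (by omega), if_neg (by omega), show t + 1 + (j - i) = t + (j - i) + 1 by omega]
      exact hadj _ (by omega)
  · intro t h1 h2
    dsimp only
    split_ifs
    · exact hT t h1 (by omega)
    · exact hT _ (by omega) (by omega)

/-- In a chordal graph, two neighbours of `v` joined by a walk whose inner vertices avoid the
closed neighbourhood of `v` are adjacent. -/
lemma adj_of_isWalkThrough {n : ℕ} {E : Set (Fin n × Fin n)} (hE : SymmEdges E)
    (hch : IsChordal E) {T : Set (Fin n)} {v a b : Fin n}
    (hT : ∀ x ∈ T, x ≠ v ∧ (v, x) ∉ E) (hav : a ≠ v) (hbv : b ≠ v)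
    (hva : (v, a) ∈ E) (hvb : (v, b) ∈ E) (hab : a ≠ b)
    (hwalk : ∃ m f, IsWalkThrough E T a b m f) : (a, b) ∈ E := by
  classical
  by_contra hnab
  obtain ⟨f, hf⟩ := Nat.find_spec hwalk
  set m := Nat.find hwalk
  have hmin : ∀ l < m, ¬ ∃ g, IsWalkThrough E T a b l g := fun l hl => Nat.find_min hwalk hl
  have hinj : ∀ i j, i < j → j ≤ m → f i ≠ f j := fun i j hij hj h =>
    hmin _ (by omega) (hf.removeLoop hij hj h)
  have hchordless : ∀ i j, i + 2 ≤ j → j ≤ m → (f i, f j) ∉ E := fun i j hij hj h =>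
    hmin _ (by omega) (hf.shortcut hij hj h)
  obtain ⟨h0, hm, hadj, hin⟩ := hf
  have hm2 : 2 ≤ m := by
    by_contra hlt
    have : m = 0 ∨ m = 1 := by omega
    rcases this with h | h
    · rw [h] at hm
      exact hab (h0.symm.trans hm)
    · have := hadj 0 (by omega)
      rw [h] at hm
      rw [h0, zero_add, hm] at this
      exact hnab this
  have hfv : ∀ t ≤ m, f t ≠ v := by
    intro t ht
    by_cases h1 : t = 0
    · rwa [h1, h0]
    by_cases h2 : t = m
    · rwa [h2, hm]
    exact (hT _ (hin t (by omega) (by omega))).1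
  have hvf : ∀ t, 0 < t → t < m → (v, f t) ∉ E := fun t h1 h2 => (hT _ (hin t h1 h2)).2
  let c : Fin (m + 1 + 1) → Fin n := fun t => if t.val ≤ m then f t.val else v
  have hc1 : ∀ t : Fin (m + 1 + 1), t.val ≤ m → c t = f t.val := fun t ht => if_pos ht
  have hc2 : ∀ t : Fin (m + 1 + 1), t.val = m + 1 → c t = v := fun t ht => if_neg (by omega)
  have hsucc1 : ∀ t : Fin (m + 1 + 1), t.val ≤ m → (t + 1).val = t.val + 1 := by
    intro t ht
    rw [Fin.val_add_one, if_neg]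
    intro h
    rw [h, Fin.val_last] at ht
    omega
  have hsucc2 : ∀ t : Fin (m + 1 + 1), t.val = m + 1 → (t + 1).val = 0 := by
    intro t ht
    rw [Fin.val_add_one, if_pos (Fin.ext (by simpa using ht))]
  have hcyc : IsCycle E c := by
    constructor
    · intro s t hst
      apply Fin.ext
      by_cases hs : s.val ≤ m <;> by_cases ht : t.val ≤ m
      · rw [hc1 s hs, hc1 t ht] at hst
        rcases lt_trichotomy s.val t.val with h | h | h
        · exact absurd hst (hinj _ _ h ht)
        · exact h
        · exact absurd hst.symm (hinj _ _ h hs)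
      · rw [hc1 s hs, hc2 t (by omega)] at hst
        exact absurd hst (hfv _ hs)
      · rw [hc2 s (by omega), hc1 t ht] at hst
        exact absurd hst.symm (hfv _ ht)
      · omega
    · intro t
      by_cases ht : t.val ≤ m
      · rw [hc1 t ht]
        by_cases htm : t.val = m
        · rw [hc2 _ (by rw [hsucc1 t ht, htm]), htm, hm]
          exact hE _ _ hvb
        · rw [hc1 (t + 1) (by rw [hsucc1 t ht]; omega), hsucc1 t ht]
          exact hadj _ (by omega)
      · have h := hsucc2 t (by omega)
        rw [hc2 t (by omega), hc1 (t + 1) (by omega), h, h0]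
        exact hva
  obtain ⟨s, t, hst, hts1, hst1, hmem⟩ := hch (m + 1) (by omega) c hcyc
  have key : ∀ s t : Fin (m + 1 + 1), s.val < t.val → t ≠ s + 1 → s ≠ t + 1 →
      (c s, c t) ∉ E := by
    intro s t hlt h1 h2 hmem
    have hs : s.val ≤ m := by omega
    have h1' : t.val ≠ s.val + 1 := fun h => h1 (Fin.ext (by rw [hsucc1 s hs, h]))
    by_cases ht : t.val ≤ m
    · rw [hc1 s hs, hc1 t ht] at hmem
      exact hchordless _ _ (by omega) ht hmem
    · have h2' : s.val ≠ 0 := fun h => h2 (Fin.ext (by rw [hsucc2 t (by omega), h]))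
      rw [hc1 s hs, hc2 t (by omega)] at hmem
      exact hvf _ (by omega) (by omega) (hE _ _ hmem)
  rcases lt_or_gt_of_ne (fun h => hst (Fin.ext h) : s.val ≠ t.val) with h | h
  · exact key s t h hts1 hst1 hmem
  · exact key t s h hst1 hts1 (hE _ _ hmem)

/-- A connection inside `T` from `x` to `y` together with an edge from `a` to `x` and an edge from
`y` to `b` yields a walk from `a` to `b` through `T`. -/
lemma exists_isWalkThrough {n : ℕ} {E : Set (Fin n × Fin n)} {T : Set (Fin n)} {a b x y : Fin n}
    (hx : x ∈ T) (hax : (a, x) ∈ E) (hyb : (y, b) ∈ E)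
    (hxy : Relation.ReflTransGen (fun s t => (s, t) ∈ E ∧ t ∈ T) x y) :
    ∃ m f, IsWalkThrough E T a b m f := by
  have extend : ∀ {y z : Fin n}, y ∈ T → (y, z) ∈ E →
      (∃ m f, 0 < m ∧ IsWalkThrough E T a y m f) →
      ∃ m f, 0 < m ∧ IsWalkThrough E T a z m f := by
    rintro y z hy hyz ⟨m, f, hm0, h0, hm, hadj, hin⟩
    refine ⟨m + 1, fun t => if t ≤ m then f t else z, by omega, by simpa using h0, by simp, ?_, ?_⟩
    · intro i hi
      dsimp only
      by_cases him : i = m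
      · rw [if_pos (by omega), if_neg (by omega), him, hm]
        exact hyz
      · rw [if_pos (by omega), if_pos (by omega)]
        exact hadj i (by omega)
    · intro i h1 h2
      dsimp only
      rw [if_pos (by omega)]
      by_cases him : i = m
      · rwa [him, hm]
      · exact hin i h1 (by omega)
  have main : y ∈ T ∧ ∃ m f, 0 < m ∧ IsWalkThrough E T a y m f := by
    clear hyb
    induction hxy with
    | refl =>
      refine ⟨hx, 1, fun t => if t = 0 then a else x, one_pos, by simp, by simp, ?_, ?_⟩
      · intro i hi
        obtain rfl : i = 0 := by omega
        simpa using hax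
      · intro i h1 h2
        omega
    | tail _ hst ih => exact ⟨hst.2, extend ih.1 hst.1 ih.2⟩
  obtain ⟨m, f, -, hf⟩ := extend main.1 hyb main.2
  exact ⟨m, f, hf⟩

/-- In a chordal graph, if `v ∈ S` has a non-neighbour in `S`, then some simplicial vertex of the
graph induced on `S` is a non-neighbour of `v`. -/
lemma exists_isSimplicialIn_not_adj {n : ℕ} {E : Set (Fin n × Fin n)} (hE : SymmEdges E)
    (hch : IsChordal E) (S : Finset (Fin n)) :
    ∀ v ∈ S, ∀ w ∈ S, w ≠ v → (v, w) ∉ E →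
      ∃ x ∈ S, x ≠ v ∧ (v, x) ∉ E ∧ IsSimplicialIn E S x := by
  classical
  induction S using Finset.strongInduction with
  | H S ih =>
  intro v hv w hw hwv hvw
  let T : Set (Fin n) := {x | x ∈ S ∧ x ≠ v ∧ (v, x) ∉ E}
  let R : Fin n → Fin n → Prop := fun s t => (s, t) ∈ E ∧ t ∈ T
  have hwT : w ∈ T := ⟨hw, hwv, hvw⟩
  let B : Finset (Fin n) := S.filter fun x => Relation.ReflTransGen R w x
  let A : Finset (Fin n) := S.filter fun x => x ∉ B ∧ ∃ y ∈ B, (y, x) ∈ E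
  have hBT : ∀ x ∈ B, x ∈ T := by
    intro x hx
    rcases (Finset.mem_filter.1 hx).2.cases_tail with h | ⟨_, _, h⟩
    · rwa [h]
    · exact h.2
  have hwB : w ∈ B := Finset.mem_filter.2 ⟨hw, Relation.ReflTransGen.refl⟩
  have hnbr : ∀ x ∈ B, ∀ y ∈ S, (x, y) ∈ E → y ∈ A ∪ B := by
    intro x hx y hy hxy
    by_cases hyB : y ∈ B
    · exact Finset.mem_union_right _ hyB
    · exact Finset.mem_union_left _ (Finset.mem_filter.2 ⟨hy, hyB, x, hx, hxy⟩)
  have hAv : ∀ a ∈ A, a ≠ v ∧ (v, a) ∈ E := by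
    intro a ha
    obtain ⟨haS, haB, y, hy, hya⟩ := Finset.mem_filter.1 ha
    have hav : a ≠ v := by
      rintro rfl
      exact (hBT y hy).2.2 (hE _ _ hya)
    refine ⟨hav, ?_⟩
    by_contra hva
    exact haB (Finset.mem_filter.2 ⟨haS, (Finset.mem_filter.1 hy).2.tail ⟨hya, haS, hav, hva⟩⟩)
  have hback : ∀ x, Relation.ReflTransGen R w x → Relation.ReflTransGen R x w := by
    intro x hx
    induction hx with
    | refl => exact Relation.ReflTransGen.refl
    | @tail b c hb hbc hind =>
      have hbT : b ∈ T := by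
        rcases hb.cases_tail with h | ⟨_, _, h⟩
        · rwa [h]
        · exact h.2
      exact Relation.ReflTransGen.head ⟨hE _ _ hbc.1, hbT⟩ hind
  have hAclique : ∀ a ∈ A, ∀ b ∈ A, a ≠ b → (a, b) ∈ E := by
    intro a ha b hb hab
    obtain ⟨-, -, x, hx, hxa⟩ := Finset.mem_filter.1 ha
    obtain ⟨-, -, y, hy, hyb⟩ := Finset.mem_filter.1 hb
    refine adj_of_isWalkThrough hE hch (T := T) (v := v) (fun x hx => hx.2) (hAv a ha).1
      (hAv b hb).1 (hAv a ha).2 (hAv b hb).2 hab ?_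
    exact exists_isWalkThrough (hBT x hx) (hE _ _ hxa) hyb
      ((hback x (Finset.mem_filter.1 hx).2).trans (Finset.mem_filter.1 hy).2)
  have hsub : A ∪ B ⊆ S := Finset.union_subset (Finset.filter_subset _ _) (Finset.filter_subset _ _)
  have hvAB : v ∉ A ∪ B := by
    intro h
    rcases Finset.mem_union.1 h with h | h
    · exact (hAv v h).1 rfl
    · exact (hBT v h).2.1 rfl
  have hss : A ∪ B ⊂ S := Finset.ssubset_iff_subset_ne.2 ⟨hsub, fun h => hvAB (h ▸ hv)⟩
  suffices hB : ∃ x ∈ B, IsSimplicialIn E (A ∪ B) x by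
    obtain ⟨x, hx, hsimp⟩ := hB
    refine ⟨x, (hBT x hx).1, (hBT x hx).2.1, (hBT x hx).2.2, ?_⟩
    intro a ha b hb hxa hxb
    exact hsimp a (hnbr x hx a ha hxa) b (hnbr x hx b hb hxb) hxa hxb
  have step : ∀ u ∈ A ∪ B, (∀ a ∈ A, a ≠ u → (u, a) ∈ E) → ∀ z ∈ A ∪ B, z ≠ u → (u, z) ∉ E →
      ∃ x ∈ B, IsSimplicialIn E (A ∪ B) x := by
    intro u hu huA z hz hzu huz
    obtain ⟨x, hx, hxu, hux, hsimp⟩ := ih _ hss u hu z hz hzu huz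
    refine ⟨x, ?_, hsimp⟩
    rcases Finset.mem_union.1 hx with h | h
    · exact absurd (huA x h hxu) hux
    · exact h
  by_cases h1 : ∃ u ∈ A, ∃ z ∈ A ∪ B, z ≠ u ∧ (u, z) ∉ E
  · obtain ⟨u, hu, z, hz, hzu, huz⟩ := h1
    exact step u (Finset.mem_union_left _ hu) (fun a ha hau => hAclique u hu a ha hau.symm)
      z hz hzu huz
  push Not at h1
  by_cases h2 : ∃ u ∈ B, ∃ z ∈ A ∪ B, z ≠ u ∧ (u, z) ∉ E
  · obtain ⟨u, hu, z, hz, hzu, huz⟩ := h2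
    have huAB := Finset.mem_union_right A hu
    exact step u huAB (fun a ha hau => hE _ _ (h1 a ha u huAB hau.symm)) z hz hzu huz
  push Not at h2
  refine ⟨w, hwB, fun a ha b hb _ _ hab => ?_⟩
  rcases Finset.mem_union.1 ha with h | h
  · exact h1 a h b hb hab.symm
  · exact h2 a h b hb hab.symm

/-- Every nonempty induced subgraph of a chordal graph has a simplicial vertex. -/
lemma exists_isSimplicialIn {n : ℕ} {E : Set (Fin n × Fin n)} (hE : SymmEdges E)
    (hch : IsChordal E) {S : Finset (Fin n)} (hS : S.Nonempty) :
    ∃ x ∈ S, IsSimplicialIn E S x := by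
  by_cases h : ∃ v ∈ S, ∃ w ∈ S, w ≠ v ∧ (v, w) ∉ E
  · obtain ⟨v, hv, w, hw, hwv, hvw⟩ := h
    obtain ⟨x, hx, -, -, hsimp⟩ := exists_isSimplicialIn_not_adj hE hch S v hv w hw hwv hvw
    exact ⟨x, hx, hsimp⟩
  · push Not at h
    obtain ⟨x, hx⟩ := hS
    exact ⟨x, hx, fun a ha b hb _ _ hab => h a ha b hb hab.symm⟩

/-- Every clique is contained in a maximal clique. -/
lemma IsClique.exists_isMaximalClique {n : ℕ} {E : Set (Fin n × Fin n)} {D : Finset (Fin n)}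
    (hD : IsClique E D) : ∃ M, D ⊆ M ∧ IsMaximalClique E M := by
  obtain ⟨M, hDM, hM⟩ := (Set.toFinite {M : Finset (Fin n) | IsClique E M}).exists_le_maximal hD
  exact ⟨M, hDM, hM.1, fun F hF hMF => (hM.eq_of_le hF hMF).symm⟩

/-- `X` vanishes outside `S × S`. -/
def SupportedOn {n : ℕ} (S : Finset (Fin n)) (X : Matrix (Fin n) (Fin n) ℝ) : Prop :=
  ∀ i j, X i j ≠ 0 → i ∈ S ∧ j ∈ S

/-- The rank-one matrix agreeing with a symmetric matrix `Z` in row and column `v`. -/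
noncomputable def pivotPart {n : ℕ} (Z : Matrix (Fin n) (Fin n) ℝ) (v : Fin n) :
    Matrix (Fin n) (Fin n) ℝ :=
  (Z v v)⁻¹ • vecMulVec (Z v) (Z v)

lemma pivotPart_apply {n : ℕ} (Z : Matrix (Fin n) (Fin n) ℝ) (v i j : Fin n) :
    pivotPart Z v i j = (Z v v)⁻¹ * (Z v i * Z v j) := by
  simp [pivotPart, vecMulVec_apply]

lemma posSemidef_pivotPart {n : ℕ} {Z : Matrix (Fin n) (Fin n) ℝ} (hZ : Z.PosSemidef)
    (v : Fin n) : (pivotPart Z v).PosSemidef := by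
  have h := posSemidef_vecMulVec_self_star (Z v)
  rw [star_trivial] at h
  exact h.smul (inv_nonneg.2 hZ.diag_nonneg)

/-- Cauchy–Schwarz for a positive semidefinite form, with one argument a basis vector. -/
lemma Matrix.PosSemidef.sq_dotProduct_le {n : ℕ} {Z : Matrix (Fin n) (Fin n) ℝ}
    (hZ : Z.PosSemidef) (v : Fin n) (x : Fin n → ℝ) :
    (Z v ⬝ᵥ x) ^ 2 ≤ Z v v * (x ⬝ᵥ (Z *ᵥ x)) := by
  have hsymm : ∀ i j, Z i j = Z j i := fun i j => by simpa using (hZ.1.apply i j).symm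
  have hcol : Z *ᵥ Pi.single v 1 = Z v := by
    ext i
    simp [hsymm i v]
  have h : ∀ t : ℝ, 0 ≤ Z v v * (t * t) + 2 * (Z v ⬝ᵥ x) * t + x ⬝ᵥ (Z *ᵥ x) := by
    intro t
    have h := hZ.dotProduct_mulVec_nonneg (x + t • Pi.single v 1)
    have hrow : (Z *ᵥ x) v = Z v ⬝ᵥ x := rfl
    simp only [star_trivial, mulVec_add, mulVec_smul, hcol, add_dotProduct, dotProduct_add,
      smul_dotProduct, dotProduct_smul, single_one_dotProduct, hrow, smul_eq_mul,
      dotProduct_comm x (Z v)] at h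
    linarith
  have := discrim_le_zero h
  rw [discrim] at this
  linarith

lemma posSemidef_sub_pivotPart {n : ℕ} {Z : Matrix (Fin n) (Fin n) ℝ} (hZ : Z.PosSemidef)
    (v : Fin n) : (Z - pivotPart Z v).PosSemidef := by
  refine PosSemidef.of_dotProduct_mulVec_nonneg (hZ.1.sub (posSemidef_pivotPart hZ v).1) ?_
  intro x
  have hcs := hZ.sq_dotProduct_le v x
  have hx := hZ.dotProduct_mulVec_nonneg x
  have hd : 0 ≤ Z v v := hZ.diag_nonneg
  rw [star_trivial] at hx ⊢
  have hform : x ⬝ᵥ (pivotPart Z v *ᵥ x) = (Z v v)⁻¹ * (Z v ⬝ᵥ x) ^ 2 := by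
    simp [pivotPart, smul_mulVec, vecMulVec_mulVec, dotProduct_comm x (Z v), sq]
  rw [sub_mulVec, dotProduct_sub, hform, sub_nonneg]
  rcases hd.eq_or_lt with h | h
  · simpa [← h] using hx
  · rwa [inv_mul_le_iff₀ h]

lemma sub_pivotPart_apply_self {n : ℕ} {Z : Matrix (Fin n) (Fin n) ℝ} (hZ : Z.PosSemidef)
    (v j : Fin n) : (Z - pivotPart Z v) v j = 0 := by
  rw [Matrix.sub_apply, pivotPart_apply]
  by_cases h : Z v v = 0
  · have hcs := hZ.sq_dotProduct_le v (Pi.single j 1)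
    rw [h, zero_mul, dotProduct_single_one] at hcs
    simp [h, pow_eq_zero_iff two_ne_zero |>.1 (le_antisymm hcs (sq_nonneg _))]
  · rw [inv_mul_cancel_left₀ h, sub_self]

/-- A positive semidefinite matrix with chordal sparsity pattern is a sum of positive semidefinite
matrices supported on the members of a family of sets that dominates all cliques. -/
lemma exists_sum_supportedOn {n p : ℕ} {E : Set (Fin n × Fin n)} (hE : SymmEdges E)
    (hch : IsChordal E) (C : Fin p → Finset (Fin n))
    (hC : ∀ D, IsClique E D → ∃ k, D ⊆ C k) (S : Finset (Fin n)) :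
    ∀ Z : Matrix (Fin n) (Fin n) ℝ, Z.PosSemidef → (∀ i j, (i, j) ∉ EStar E → Z i j = 0) →
      SupportedOn S Z →
      ∃ Y : Fin p → Matrix (Fin n) (Fin n) ℝ,
        (∀ k, (Y k).PosSemidef) ∧ (∀ k, SupportedOn (C k) (Y k)) ∧ Z = ∑ k, Y k := by
  classical
  induction S using Finset.strongInduction with
  | H S ih =>
  intro Z hZ hsparse hsupp
  rcases S.eq_empty_or_nonempty with rfl | hS
  · refine ⟨fun _ => 0, fun _ => PosSemidef.zero, fun _ i j h => absurd rfl h, ?_⟩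
    ext i j
    by_contra h
    exact absurd (hsupp i j (by simpa using h)).1 (Finset.notMem_empty i)
  obtain ⟨v, hv, hsimp⟩ := exists_isSimplicialIn hE hch hS
  let D : Finset (Fin n) := S.filter fun x => x = v ∨ (v, x) ∈ E
  have hD : IsClique E D := by
    intro a ha b hb hab
    obtain ⟨haS, ha⟩ := Finset.mem_filter.1 ha
    obtain ⟨hbS, hb⟩ := Finset.mem_filter.1 hb
    rcases ha with rfl | ha
    · rcases hb with rfl | hb
      · exact absurd rfl hab
      · exact hb
    · rcases hb with rfl | hb
      · exact hE _ _ ha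
      · exact hsimp a haS b hbS ha hb hab
  have hrow : ∀ j, Z v j ≠ 0 → j ∈ D := by
    intro j hj
    refine Finset.mem_filter.2 ⟨(hsupp v j hj).2, ?_⟩
    by_contra h
    push Not at h
    refine hj (hsparse v j ?_)
    rintro (h' | h')
    · exact h.2 h'
    · exact h.1 (Eq.symm h')
  have hYD : SupportedOn D (pivotPart Z v) := by
    intro i j h
    rw [pivotPart_apply] at h
    have h' := right_ne_zero_of_mul h
    exact ⟨hrow i (left_ne_zero_of_mul h'), hrow j (right_ne_zero_of_mul h')⟩
  have hrest := posSemidef_sub_pivotPart hZ v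
  obtain ⟨Y, hYpsd, hYsupp, hYsum⟩ := ih (S.erase v) (Finset.erase_ssubset hv)
    (Z - pivotPart Z v) hrest (by
      intro i j hij
      rw [Matrix.sub_apply, hsparse i j hij, zero_sub, neg_eq_zero]
      by_contra h
      have hmem := hYD i j h
      by_cases hne : i = j
      · exact hij (Or.inr hne)
      · exact hij (Or.inl (hD i hmem.1 j hmem.2 hne))) (by
      intro i j hij
      have hi : i ≠ v := by
        rintro rfl
        exact hij (sub_pivotPart_apply_self hZ i j)
      have hj : j ≠ v := by
        rintro rfl
        refine hij ?_
        rw [← hrest.1.apply i j, sub_pivotPart_apply_self hZ j i, star_zero]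
      have hS : i ∈ S ∧ j ∈ S := by
        by_cases hz : Z i j = 0
        · rw [Matrix.sub_apply, hz, zero_sub, neg_ne_zero] at hij
          have := hYD i j hij
          exact ⟨(Finset.mem_filter.1 this.1).1, (Finset.mem_filter.1 this.2).1⟩
        · exact hsupp i j hz
      exact ⟨Finset.mem_erase.2 ⟨hi, hS.1⟩, Finset.mem_erase.2 ⟨hj, hS.2⟩⟩)
  obtain ⟨k₀, hk₀⟩ := hC D hD
  refine ⟨fun k => Y k + if k = k₀ then pivotPart Z v else 0, ?_, ?_, ?_⟩
  · intro k
    refine (hYpsd k).add ?_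
    split_ifs
    · exact posSemidef_pivotPart hZ v
    · exact PosSemidef.zero
  · intro k i j h
    by_cases hy : Y k i j = 0
    · by_cases hk : k = k₀
      · subst hk
        have := hYD i j (by simpa [hy] using h)
        exact ⟨hk₀ this.1, hk₀ this.2⟩
      · simp [hy, hk] at h
    · exact hYsupp k i j hy
  · rw [Finset.sum_add_distrib, ← hYsum]
    simp

lemma selector_transpose_mul_self {n : ℕ} (C : Finset (Fin n)) :
    (selector C)ᵀ * selector C = diagonal fun i => if i ∈ C then 1 else 0 := by
  classical
  ext i j
  rw [mul_apply, diagonal_apply]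
  simp only [selector, transpose_apply, of_apply]
  let g : Fin n → ℝ := fun c => (if c = i then 1 else 0) * if c = j then 1 else 0
  have hsum : ∑ c, g (C.orderIsoOfFin rfl c).1 = ∑ c ∈ C, g c :=
    (Equiv.sum_comp (C.orderIsoOfFin rfl).toEquiv fun c : C => g c.1).trans
      (Finset.sum_coe_sort C g)
  refine hsum.trans ?_
  simp only [g, ite_mul, one_mul, zero_mul, Finset.sum_ite_eq']
  split_ifs <;> rfl

/-- A matrix supported on `C` is recovered from its principal submatrix indexed by `C`. -/
lemma SupportedOn.selector_eq {n : ℕ} {C : Finset (Fin n)} {Y : Matrix (Fin n) (Fin n) ℝ}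
    (hY : SupportedOn C Y) :
    (selector C)ᵀ * (selector C * Y * (selector C)ᵀ) * selector C = Y := by
  have h : (selector C)ᵀ * (selector C * Y * (selector C)ᵀ) * selector C =
      ((selector C)ᵀ * selector C) * Y * ((selector C)ᵀ * selector C) := by
    simp only [Matrix.mul_assoc]
  rw [h, selector_transpose_mul_self]
  ext i j
  rw [mul_diagonal, diagonal_mul]
  by_cases hij : Y i j = 0
  · simp [hij]
  · simp [hY i j hij]

/-- **Agler–Griewank–Kakimura decomposition theorem.** Let `G(V,E)` be a chordal graph with
maximal cliques `C_1, …, C_p` and let `Z ∈ S^n(E,0)`.  Then `Z ∈ S^n_+(E,0)` (i.e. `Z` is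
positive semidefinite with sparsity pattern `E`) if and only if there exist matrices
`Z_k ∈ S^{|C_k|}` with `Z_k ⪰ 0` such that `Z = Σ_k E_{C_k}ᵀ Z_k E_{C_k}`. -/
theorem chordal_psd_decomposition {n p : ℕ} (E : Set (Fin n × Fin n)) (hE : SymmEdges E)
    (hchordal : IsChordal E) (C : Fin p → Finset (Fin n))
    (hmax : ∀ k : Fin p, IsMaximalClique E (C k))
    (hall : ∀ D : Finset (Fin n), IsMaximalClique E D → ∃ k : Fin p, C k = D)
    (Z : Matrix (Fin n) (Fin n) ℝ) (hZ : SparseSym E Z) :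
    SparsePSD E Z ↔
      ∃ Zk : (k : Fin p) → Matrix (Fin (C k).card) (Fin (C k).card) ℝ,
        (∀ k : Fin p, (Zk k).PosSemidef) ∧
        Z = ∑ k : Fin p, (selector (C k))ᵀ * Zk k * selector (C k) := by
  constructor
  · rintro ⟨-, hpsd⟩
    obtain ⟨Y, hYpsd, hYsupp, hYsum⟩ := exists_sum_supportedOn hE hchordal C (fun D hD => by
      obtain ⟨M, hDM, hM⟩ := hD.exists_isMaximalClique
      obtain ⟨k, rfl⟩ := hall M hM
      exact ⟨k, hDM⟩) Finset.univ Z hpsd hZ.2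
      (fun i j _ => ⟨Finset.mem_univ i, Finset.mem_univ j⟩)
    refine ⟨fun k => selector (C k) * Y k * (selector (C k))ᵀ, fun k => ?_, ?_⟩
    · simpa using (hYpsd k).mul_mul_conjTranspose_same (selector (C k))
    · rw [hYsum]
      exact Finset.sum_congr rfl fun k _ => (hYsupp k).selector_eq.symm
  · rintro ⟨Zk, hpsd, hsum⟩
    refine ⟨hZ, ?_⟩
    rw [hsum]
    refine posSemidef_sum _ fun k _ => ?_
    simpa using (hpsd k).conjTranspose_mul_mul_same (selector (C k))
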